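/- arXiv:0911.4467 — 2 statements merged into one kernel-verified Lean document; each statement's English description precedes it below -/
import Mathlib

section
/- Let γ : ℝ → ℝ³ be a pseudo-arc parametrized null curve with curvature κ and Frenet frame (t,n,b), let p₃ : ℝ → ℝ be smooth and c ∈ ℝ a constant, and set p₂ := −p₃', p₁(s) := (1/2)p₃''(s) + ∫₀ˢ κ'(u)p₃(u)du + c. Then there exists a smooth map Γ : ℝ × ℝ → ℝ³ such that each Γ(·,t) is a pseudo-arc parametrized null curve, Γ(·,0) = γ, and ∂Γ/∂t(s,0) = p₁(s)t(s) + p₂(s)n(s) + p₃(s)b(s) for all s. -/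
noncomputable section

/-- The Minkowski bilinear form on `ℝ³`: `⟨x,y⟩ = -(x¹y³ + x³y¹) + x²y²`. -/
def mink (x y : Fin 3 → ℝ) : ℝ := -(x 0 * y 2 + x 2 * y 0) + x 1 * y 1

/-- Partial derivative in the first (space) variable, vector-valued. -/
def dsV (f : ℝ → ℝ → Fin 3 → ℝ) : ℝ → ℝ → Fin 3 → ℝ := fun s t => deriv (fun x => f x t) s

open MeasureTheory
open scoped Topology

lemma hasFDerivAt_paramInt {H E : Type} [NormedAddCommGroup H] [NormedSpace ℝ H] [ProperSpace H]
    [NormedAddCommGroup E] [NormedSpace ℝ E]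
    (F : H × ℝ → E) (hF : ContDiff ℝ 1 F) (a b : ℝ) (x₀ : H) :
    HasFDerivAt (fun x => ∫ u in a..b, F (x, u))
      (∫ u in a..b, (fderiv ℝ F (x₀, u)).comp (ContinuousLinearMap.inl ℝ H ℝ)) x₀ := by
  have hc : Continuous fun p : H × ℝ => (fderiv ℝ F p).comp (ContinuousLinearMap.inl ℝ H ℝ) :=
    (hF.continuous_fderiv (by simp)).clm_comp continuous_const
  obtain ⟨M, hM⟩ := ((isCompact_closedBall x₀ 1).prod (isCompact_uIcc (a := a) (b := b))).exists_bound_of_continuousOn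
    hc.continuousOn
  refine intervalIntegral.hasFDerivAt_integral_of_dominated_of_fderiv_le
    (F := fun x u => F (x, u)) (s := Metric.closedBall x₀ 1)
    (F' := fun x u => (fderiv ℝ F (x, u)).comp (ContinuousLinearMap.inl ℝ H ℝ))
    (bound := fun _ => M) (Metric.closedBall_mem_nhds _ one_pos) ?_ ?_ ?_ ?_ ?_ ?_
  · exact Filter.Eventually.of_forall fun x =>
      (hF.continuous.comp (by fun_prop : Continuous fun u : ℝ => (x, u))).aestronglyMeasurable
  · exact (hF.continuous.comp (by fun_prop : Continuous fun u : ℝ => (x₀, u))).intervalIntegrable _ _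
  · exact (hc.comp (by fun_prop : Continuous fun u : ℝ => (x₀, u))).aestronglyMeasurable
  · exact Filter.Eventually.of_forall fun u hu x hx =>
      hM (x, u) ⟨hx, Set.uIoc_subset_uIcc hu⟩
  · exact intervalIntegrable_const
  · refine Filter.Eventually.of_forall fun u hu x hx => ?_
    have h1 : HasFDerivAt F (fderiv ℝ F (x, u)) (x, u) :=
      ((hF.differentiable (by simp)) (x, u)).hasFDerivAt
    exact h1.comp x (hasFDerivAt_prodMk_left x u)

lemma contDiff_paramInt_nat {H : Type} [NormedAddCommGroup H] [NormedSpace ℝ H] [ProperSpace H]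
    (a b : ℝ) (n : ℕ) : ∀ {E : Type} [NormedAddCommGroup E] [NormedSpace ℝ E]
    (F : H × ℝ → E) (_ : ContDiff ℝ (⊤ : ℕ∞) F),
    ContDiff ℝ n (fun x => ∫ u in a..b, F (x, u)) := by
  induction n with
  | zero =>
    intro E _ _ F hF
    have h1 : ContDiff ℝ 1 F := hF.of_le (by exact_mod_cast le_top)
    exact contDiff_zero.2 (continuous_iff_continuousAt.2 fun x =>
      (hasFDerivAt_paramInt F h1 a b x).continuousAt)
  | succ n ih =>
    intro E _ _ F hF
    have h1 : ContDiff ℝ 1 F := hF.of_le (by exact_mod_cast le_top)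
    rw [show ((n + 1 : ℕ) : WithTop ℕ∞) = n + 1 by norm_cast]
    refine contDiff_succ_iff_hasFDerivAt.2 ⟨_, ?_, fun x => hasFDerivAt_paramInt F h1 a b x⟩
    refine ih (fun p : H × ℝ => (fderiv ℝ F p).comp (ContinuousLinearMap.inl ℝ H ℝ)) ?_
    exact (hF.fderiv_right (by simp)).clm_comp contDiff_const

lemma contDiff_prim {E : Type} [NormedAddCommGroup E] [NormedSpace ℝ E]
    (g : ℝ × ℝ → E) (hg : ContDiff ℝ (⊤ : ℕ∞) g) :
    ContDiff ℝ (⊤ : ℕ∞) (fun p : ℝ × ℝ => ∫ u in (0:ℝ)..p.1, g (u, p.2)) := by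
  have h : (fun p : ℝ × ℝ => ∫ u in (0:ℝ)..p.1, g (u, p.2)) =
      fun p : ℝ × ℝ => p.1 • ∫ u in (0:ℝ)..1, (fun q : (ℝ × ℝ) × ℝ => g (q.1.1 * q.2, q.1.2)) (p, u) := by
    ext p
    have := intervalIntegral.smul_integral_comp_mul_left (a := 0) (b := 1) (fun u => g (u, p.2)) p.1
    simpa using this.symm
  rw [h]
  refine contDiff_fst.smul (contDiff_infty.2 fun n => contDiff_paramInt_nat 0 1 n
    (fun q : (ℝ × ℝ) × ℝ => g (q.1.1 * q.2, q.1.2)) ?_)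
  exact hg.comp (by fun_prop)

lemma hasDerivAt_prim_param {E : Type} [NormedAddCommGroup E] [NormedSpace ℝ E]
    (g : ℝ × ℝ → E) (hg : ContDiff ℝ (⊤ : ℕ∞) g) (g' : ℝ → E)
    (h : ∀ u, HasDerivAt (fun t => g (u, t)) (g' u) 0) (s : ℝ) :
    HasDerivAt (fun t => ∫ u in (0:ℝ)..s, g (u, t)) (∫ u in (0:ℝ)..s, g' u) 0 := by
  have hF : ContDiff ℝ 1 (fun p : ℝ × ℝ => g (p.2, p.1)) :=
    (hg.of_le (by exact_mod_cast le_top)).comp (by fun_prop)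
  have h1 := (hasFDerivAt_paramInt _ hF 0 s 0).hasDerivAt
  convert h1 using 1
  rw [ContinuousLinearMap.intervalIntegral_apply]
  · refine intervalIntegral.integral_congr fun u _ => ?_
    have h2 : HasFDerivAt (fun p : ℝ × ℝ => g (p.2, p.1)) (fderiv ℝ (fun p : ℝ × ℝ => g (p.2, p.1)) (0, u)) (0, u) :=
      ((hF.differentiable (by simp)) (0, u)).hasFDerivAt
    have h3 := (h2.comp (0:ℝ) (hasFDerivAt_prodMk_left (0:ℝ) u)).hasDerivAt
    exact (h u).unique h3
  · refine Continuous.intervalIntegrable ?_ _ _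
    have hc : Continuous fun p : ℝ × ℝ => (fderiv ℝ (fun p : ℝ × ℝ => g (p.2, p.1)) p).comp (ContinuousLinearMap.inl ℝ ℝ ℝ) :=
      (hF.continuous_fderiv (by simp)).clm_comp continuous_const
    exact hc.comp (by fun_prop : Continuous fun u : ℝ => ((0:ℝ), u))

lemma hasDerivAt_prim {E : Type} [NormedAddCommGroup E] [NormedSpace ℝ E] [CompleteSpace E]
    (g : ℝ × ℝ → E) (hg : ContDiff ℝ (⊤ : ℕ∞) g) (s t : ℝ) :
    HasDerivAt (fun s => ∫ u in (0:ℝ)..s, g (u, t)) (g (s, t)) s := by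
  have hc : Continuous fun u => g (u, t) := hg.continuous.comp (by fun_prop)
  exact (hc.integral_hasStrictDerivAt 0 s).hasDerivAt

lemma mink_deriv {f g : ℝ → Fin 3 → ℝ} {f' g' : Fin 3 → ℝ} {s : ℝ}
    (hf : HasDerivAt f f' s) (hg : HasDerivAt g g' s) :
    HasDerivAt (fun s => mink (f s) (g s)) (mink f' (g s) + mink (f s) g') s := by
  have hf' := hasDerivAt_pi.1 hf
  have hg' := hasDerivAt_pi.1 hg
  unfold mink
  refine HasDerivAt.congr_deriv (((((hf' 0).fun_mul (hg' 2)).fun_add ((hf' 2).fun_mul (hg' 0))).fun_neg).fun_add ((hf' 1).fun_mul (hg' 1))) (Eq.symm ?_)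
  ring

lemma mink_comm' (x y : Fin 3 → ℝ) : mink x y = mink y x := by unfold mink; ring

lemma mink_nondeg (t n g X : Fin 3 → ℝ) (htt : mink t t = 0) (htn : mink t n = 0)
    (htg : mink t g = -1) (hnn : mink n n = 1) (hng : mink n g = 0)
    (h1 : mink t X = 0) (h2 : mink n X = 0) (h3 : mink g X = 0) : X = 0 := by
  set D := t 0 * (n 1 * g 2 - n 2 * g 1) - t 1 * (n 0 * g 2 - n 2 * g 0)
    + t 2 * (n 0 * g 1 - n 1 * g 0) with hD
  have hD2 : D ^ 2 = 1 := by
    have : D ^ 2 = -(mink t t * (mink n n * mink g g - mink n g ^ 2)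
      - mink t n * (mink t n * mink g g - mink n g * mink t g)
      + mink t g * (mink t n * mink n g - mink n n * mink t g)) := by
      rw [hD]; unfold mink; ring
    rw [this, htt, htn, htg, hnn, hng]; ring
  have hD0 : D ≠ 0 := by intro h; rw [h] at hD2; norm_num at hD2
  unfold mink at h1 h2 h3
  have e0 : D * X 0 = 0 := by
    rw [hD]
    linear_combination (-(n 0 * g 1 - n 1 * g 0)) * h1 + (t 0 * g 1 - t 1 * g 0) * h2
      - (t 0 * n 1 - t 1 * n 0) * h3
  have e1 : D * X 1 = 0 := by
    rw [hD]
    linear_combination (-(n 0 * g 2 - n 2 * g 0)) * h1 + (t 0 * g 2 - t 2 * g 0) * h2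
      - (t 0 * n 2 - t 2 * n 0) * h3
  have e2 : D * X 2 = 0 := by
    rw [hD]
    linear_combination (-(n 1 * g 2 - n 2 * g 1)) * h1 + (t 1 * g 2 - t 2 * g 1) * h2
      - (t 1 * n 2 - t 2 * n 1) * h3
  ext i
  fin_cases i
  · simpa [hD0] using e0
  · simpa [hD0] using e1
  · simpa [hD0] using e2

lemma core (γ g1 g2 V : ℝ → Fin 3 → ℝ) (P P' : ℝ → ℝ)
    (hg1 : ContDiff ℝ (⊤ : ℕ∞) g1) (hg2 : ContDiff ℝ (⊤ : ℕ∞) g2)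
    (hP : ContDiff ℝ (⊤ : ℕ∞) P) (hP' : ContDiff ℝ (⊤ : ℕ∞) P')
    (d1 : ∀ s, HasDerivAt γ (g1 s) s) (d2 : ∀ s, HasDerivAt g1 (g2 s) s)
    (dP : ∀ s, HasDerivAt P (P' s) s)
    (hnull : ∀ s, mink (g1 s) (g1 s) = 0)
    (hfut : ∀ s, mink (g1 s) ![1, 0, 1] < 0)
    (hpa : ∀ s, mink (g2 s) (g2 s) = 1)
    (dV : ∀ s, HasDerivAt V (P s • g2 s - P' s • g1 s) s) :
    ∃ Γ : ℝ → ℝ → Fin 3 → ℝ,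
      ContDiff ℝ (⊤ : ℕ∞) (fun p : ℝ × ℝ => Γ p.1 p.2) ∧
      (∀ t₀ : ℝ, ∀ s : ℝ,
        mink (dsV Γ s t₀) (dsV Γ s t₀) = 0 ∧
        mink (dsV Γ s t₀) ![1, 0, 1] < 0 ∧
        mink (dsV (dsV Γ) s t₀) (dsV (dsV Γ) s t₀) = 1) ∧
      (∀ s, Γ s 0 = γ s) ∧
      (∀ s, deriv (fun τ => Γ s τ) 0 = V s) := by
  have hr : √(2:ℝ) ^ 2 = 2 := Real.sq_sqrt (by norm_num)
  have hr0 : √(2:ℝ) ≠ 0 := by positivity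
  set r := √(2:ℝ) with hrdef
  have c1 : ∀ i, ContDiff ℝ (⊤ : ℕ∞) fun s => g1 s i := contDiff_pi.1 hg1
  have c2 : ∀ i, ContDiff ℝ (⊤ : ℕ∞) fun s => g2 s i := contDiff_pi.1 hg2
  have d2' : ∀ i s, HasDerivAt (fun s => g1 s i) (g2 s i) s := fun i s => hasDerivAt_pi.1 (d2 s) i
  have hnull' : ∀ s, g1 s 1 ^ 2 = 2 * g1 s 0 * g1 s 2 := by
    intro s; have := hnull s; unfold mink at this; linarith
  have hpa' : ∀ s, g2 s 1 ^ 2 = 1 + 2 * g2 s 0 * g2 s 2 := by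
    intro s; have := hpa s; unfold mink at this; linarith
  have hort : ∀ s, g1 s 1 * g2 s 1 = g1 s 0 * g2 s 2 + g1 s 2 * g2 s 0 := by
    intro s
    have h := (mink_deriv (d2 s) (d2 s)).unique (by
      simp only [hnull]; exact hasDerivAt_const s (0:ℝ))
    unfold mink at h; linarith
  obtain ⟨A, hA⟩ : ∃ A : ℝ → ℝ, A = fun s => g1 s 0 + g1 s 2 := ⟨_, rfl⟩
  obtain ⟨A', hA'⟩ : ∃ A' : ℝ → ℝ, A' = fun s => g2 s 0 + g2 s 2 := ⟨_, rfl⟩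
  have Apos : ∀ s, 0 < A s := by
    intro s; have := hfut s; simp [mink] at this; rw [hA]; simp; linarith
  have A0 : ∀ s, A s ≠ 0 := fun s => (Apos s).ne'
  have cA : ContDiff ℝ (⊤ : ℕ∞) A := by rw [hA]; exact (c1 0).add (c1 2)
  have cA' : ContDiff ℝ (⊤ : ℕ∞) A' := by rw [hA']; exact (c2 0).add (c2 2)
  have dA : ∀ s, HasDerivAt A (A' s) s := by
    intro s; rw [hA, hA']; exact (d2' 0 s).add (d2' 2 s)
  obtain ⟨C, hC⟩ : ∃ C : ℝ → ℝ, C = fun s => (g1 s 0 - g1 s 2) / A s := ⟨_, rfl⟩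
  obtain ⟨S, hS⟩ : ∃ S : ℝ → ℝ, S = fun s => (r * g1 s 1) / A s := ⟨_, rfl⟩
  obtain ⟨w, hw⟩ : ∃ w : ℝ → ℝ, w = fun s =>
    r * ((g1 s 0 - g1 s 2) * g2 s 1 - g1 s 1 * (g2 s 0 - g2 s 2)) / A s ^ 2 := ⟨_, rfl⟩
  have cC : ContDiff ℝ (⊤ : ℕ∞) C := by rw [hC]; exact ((c1 0).sub (c1 2)).div cA A0
  have cS : ContDiff ℝ (⊤ : ℕ∞) S := by rw [hS]; exact (contDiff_const.mul (c1 1)).div cA A0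
  have cw : ContDiff ℝ (⊤ : ℕ∞) w := by
    rw [hw]
    exact (contDiff_const.mul ((((c1 0).sub (c1 2)).mul (c2 1)).sub
      ((c1 1).mul ((c2 0).sub (c2 2))))).div (cA.pow 2) (fun s => pow_ne_zero 2 (A0 s))
  have hCS : ∀ s, C s ^ 2 + S s ^ 2 = 1 := by
    intro s
    have h0 := A0 s
    rw [hC, hS]; dsimp only; field_simp
    rw [hr, hnull' s, hA]; dsimp only; ring
  have dC : ∀ s, HasDerivAt C (-(S s * w s)) s := by
    intro s
    have h0 := A0 s
    have := ((d2' 0 s).fun_sub (d2' 2 s)).fun_div (dA s) h0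
    rw [← hC] at this
    refine HasDerivAt.congr_deriv (this) (Eq.symm ?_)
    rw [hS, hw]; dsimp only; field_simp
    have e1 := hnull' s
    have e2 := hort s
    rw [hr, hA, hA']; dsimp only
    linear_combination 2 * (g2 s 0 - g2 s 2) * e1 - 2 * (g1 s 0 - g1 s 2) * e2
  have dS : ∀ s, HasDerivAt S (C s * w s) s := by
    intro s
    have h0 := A0 s
    have := ((d2' 1 s).const_mul r).fun_div (dA s) h0
    rw [← hS] at this
    refine HasDerivAt.congr_deriv (this) (Eq.symm ?_)
    rw [hC, hw]; dsimp only; field_simp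
    have e1 := hnull' s
    have e2 := hort s
    rw [hA, hA']; dsimp only
    linear_combination 2 * g2 s 1 * e1 - 2 * g1 s 1 * e2
  have hAw : ∀ s, A s ^ 2 * w s ^ 2 = 2 := by
    intro s
    have h0 := A0 s
    rw [hw]; dsimp only; field_simp
    rw [hr, hA]; dsimp only
    have e1 := hnull' s
    have e2 := hort s
    have e3 := hpa' s
    have e4 : (g1 s 0 * g2 s 2 + g1 s 2 * g2 s 0) ^ 2 =
        2 * g1 s 0 * g1 s 2 * (1 + 2 * g2 s 0 * g2 s 2) := by rw [← e2, mul_pow, e1, e3]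
    linear_combination 2 * ((g1 s 0 - g1 s 2) ^ 2 * e3
      - 2 * (g1 s 0 - g1 s 2) * (g2 s 0 - g2 s 2) * e2 + (g2 s 0 - g2 s 2) ^ 2 * e1 + 2 * e4)
  have w0 : ∀ s, w s ≠ 0 := by
    intro s h; have := hAw s; rw [h] at this; norm_num at this
  have dw : ∀ s, HasDerivAt w (-(A' s * w s / A s)) s := by
    intro s
    have h1 : HasDerivAt w (deriv w s) s := ((cw.differentiable (by simp)) s).hasDerivAt
    have h2 := (((dA s).fun_pow 2).fun_mul (h1.fun_pow 2)).unique (by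
      simp only [hAw]; exact hasDerivAt_const s (2:ℝ))
    refine h1.congr_deriv (Eq.symm ?_)
    have h0 := A0 s
    have hw0 := w0 s
    field_simp
    have : (2 * A s * w s) * (A' s * w s + A s * deriv w s) = 0 := by
      push_cast at h2; ring_nf at h2 ⊢; linarith
    have h3 := (mul_eq_zero.1 this).resolve_left (by positivity)
    linarith
  obtain ⟨m, hm⟩ : ∃ m : ℝ → ℝ, m = fun s => P' s - P s * A' s / A s := ⟨_, rfl⟩
  have cm : ContDiff ℝ (⊤ : ℕ∞) m := by rw [hm]; exact hP'.sub ((hP.mul cA').div cA A0)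
  have dPw : ∀ s, HasDerivAt (fun s => P s * w s) (w s * m s) s := by
    intro s
    refine HasDerivAt.congr_deriv ((dP s).fun_mul (dw s)) (Eq.symm ?_)
    rw [hm]; dsimp only; ring
  -- the angle
  obtain ⟨gα, hgα⟩ : ∃ gα : ℝ × ℝ → ℝ, gα = fun p => w p.1 * (Real.exp (p.2 * m p.1) - 1) :=
    ⟨_, rfl⟩
  have cgα : ContDiff ℝ (⊤ : ℕ∞) gα := by rw [hgα]; fun_prop
  obtain ⟨α, hα⟩ : ∃ α : ℝ × ℝ → ℝ,
    α = fun p => p.2 * (P 0 * w 0) + ∫ u in (0:ℝ)..p.1, gα (u, p.2) := ⟨_, rfl⟩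
  have cα : ContDiff ℝ (⊤ : ℕ∞) α := by
    rw [hα]; exact (contDiff_snd.mul contDiff_const).add (contDiff_prim gα cgα)
  have dαs : ∀ s t, HasDerivAt (fun s => α (s, t)) (gα (s, t)) s := by
    intro s t; rw [hα]; exact HasDerivAt.const_add (t * (P 0 * w 0)) (hasDerivAt_prim gα cgα s t)
  have α0 : ∀ s, α (s, 0) = 0 := by intro s; simp [hα, hgα]
  have dαt : ∀ s, HasDerivAt (fun t => α (s, t)) (P s * w s) 0 := by
    intro s
    have h1 := hasDerivAt_prim_param gα cgα (fun u => w u * m u) (by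
      intro u
      rw [hgα]
      have := ((((hasDerivAt_id (0:ℝ)).mul_const (m u)).exp).sub_const 1).const_mul (w u)
      simpa using this) s
    have h2 : ∫ u in (0:ℝ)..s, w u * m u = P s * w s - P 0 * w 0 :=
      intervalIntegral.integral_eq_sub_of_hasDerivAt (fun x _ => dPw x)
        ((cw.mul cm).continuous.intervalIntegrable _ _)
    rw [h2] at h1
    have h3 := ((hasDerivAt_id (0:ℝ)).mul_const (P 0 * w 0)).add h1
    rw [hα]
    refine HasDerivAt.congr_deriv (h3) (Eq.symm ?_)
    ring
  obtain ⟨a, ha⟩ : ∃ a : ℝ × ℝ → ℝ, a = fun p => A p.1 * Real.exp (-(p.2 * m p.1)) := ⟨_, rfl⟩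
  obtain ⟨Ct, hCt⟩ : ∃ Ct : ℝ × ℝ → ℝ,
    Ct = fun p => C p.1 * Real.cos (α p) - S p.1 * Real.sin (α p) := ⟨_, rfl⟩
  obtain ⟨St, hSt⟩ : ∃ St : ℝ × ℝ → ℝ,
    St = fun p => S p.1 * Real.cos (α p) + C p.1 * Real.sin (α p) := ⟨_, rfl⟩
  have ca : ContDiff ℝ (⊤ : ℕ∞) a := by rw [ha]; fun_prop
  have cCt : ContDiff ℝ (⊤ : ℕ∞) Ct := by rw [hCt]; fun_prop
  have cSt : ContDiff ℝ (⊤ : ℕ∞) St := by rw [hSt]; fun_prop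
  have hCSt : ∀ p, Ct p ^ 2 + St p ^ 2 = 1 := by
    intro p
    have e1 := hCS p.1
    have e2 := Real.sin_sq_add_cos_sq (α p)
    rw [hCt, hSt]; dsimp only
    linear_combination (Real.sin (α p) ^ 2 + Real.cos (α p) ^ 2) * e1 + e2
  have dCt : ∀ s t, HasDerivAt (fun s => Ct (s, t)) (-(St (s, t) * (w s * Real.exp (t * m s)))) s := by
    intro s t
    rw [hCt, hSt]
    refine HasDerivAt.congr_deriv (((dC s).fun_mul (dαs s t).cos).fun_sub ((dS s).fun_mul (dαs s t).sin)) (Eq.symm ?_)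
    rw [hgα]; dsimp only; ring
  have dSt : ∀ s t, HasDerivAt (fun s => St (s, t)) (Ct (s, t) * (w s * Real.exp (t * m s))) s := by
    intro s t
    rw [hCt, hSt]
    refine HasDerivAt.congr_deriv (((dS s).fun_mul (dαs s t).cos).fun_add ((dC s).fun_mul (dαs s t).sin)) (Eq.symm ?_)
    rw [hgα]; dsimp only; ring
  have das : ∀ s t, ∃ q, HasDerivAt (fun s => a (s, t)) q s := fun s t =>
    ⟨_, ((ca.comp (by fun_prop : ContDiff ℝ (⊤ : ℕ∞) fun s : ℝ => (s, t))).differentiable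
      (by simp) s).hasDerivAt⟩
  obtain ⟨T, hT⟩ : ∃ T : ℝ × ℝ → Fin 3 → ℝ, T = fun p =>
    ![a p / 2 * (1 + Ct p), a p / 2 * (r * St p), a p / 2 * (1 - Ct p)] := ⟨_, rfl⟩
  have cT : ContDiff ℝ (⊤ : ℕ∞) T := by
    rw [hT]
    refine contDiff_pi.2 fun i => ?_
    fin_cases i <;> simp <;> fun_prop
  have T0 : ∀ s, T (s, 0) = g1 s := by
    intro s
    have h0 := A0 s
    rw [hT]
    ext i
    fin_cases i
    · simp [ha, hCt, α0, hC]; field_simp; rw [hA]; ring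
    · simp [ha, hSt, α0, hS]; field_simp; rw [hr]
    · simp [ha, hCt, α0, hC]; field_simp; rw [hA]; ring
  have g1eq : ∀ s, g1 s = ![A s / 2 * (1 + C s), A s / 2 * (r * S s), A s / 2 * (1 - C s)] := by
    intro s
    rw [← T0, hT]; simp [ha, hCt, hSt, α0]
  have g2eq : ∀ s, g2 s = ![A' s / 2 * (1 + C s) - A s / 2 * (S s * w s),
      A' s / 2 * (r * S s) + A s / 2 * (r * (C s * w s)),
      A' s / 2 * (1 - C s) + A s / 2 * (S s * w s)] := by
    intro s
    refine (d2 s).unique ?_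
    rw [show g1 = _ from funext g1eq]
    refine hasDerivAt_pi.2 fun i => ?_
    fin_cases i
    · simp
      refine HasDerivAt.congr_deriv (((dA s).div_const 2).fun_mul ((dC s).const_add 1)) (Eq.symm ?_)
      ring
    · simp
      refine HasDerivAt.congr_deriv (((dA s).div_const 2).fun_mul ((dS s).const_mul r)) (Eq.symm ?_)
      rfl
    · simp
      refine HasDerivAt.congr_deriv (((dA s).div_const 2).fun_mul ((dC s).const_sub 1)) (Eq.symm ?_)
      ring
  have dTt : ∀ s, HasDerivAt (fun t => T (s, t)) (P s • g2 s - P' s • g1 s) 0 := by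
    intro s
    have h0 := A0 s
    have da : HasDerivAt (fun t => a (s, t)) (-(A s * m s)) 0 := by
      have := ((((hasDerivAt_id (0:ℝ)).mul_const (m s)).fun_neg).exp).const_mul (A s)
      rw [ha]
      simpa using this
    have dc : HasDerivAt (fun t => Ct (s, t)) (-(S s * (P s * w s))) 0 := by
      have := ((dαt s).cos.const_mul (C s)).fun_sub ((dαt s).sin.const_mul (S s))
      rw [hCt]
      simpa [α0] using this
    have ds : HasDerivAt (fun t => St (s, t)) (C s * (P s * w s)) 0 := by
      have := ((dαt s).cos.const_mul (S s)).fun_add ((dαt s).sin.const_mul (C s))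
      rw [hSt]
      simpa [α0] using this
    have ea : a (s, 0) = A s := by simp [ha]
    have ec : Ct (s, 0) = C s := by simp [hCt, α0]
    have es : St (s, 0) = S s := by simp [hSt, α0]
    rw [hT, g1eq, g2eq]
    refine hasDerivAt_pi.2 fun i => ?_
    fin_cases i
    · simp
      refine HasDerivAt.congr_deriv ((da.div_const 2).fun_mul (dc.const_add 1)) (Eq.symm ?_)
      rw [ea, ec, hm]; field_simp; ring
    · simp
      refine HasDerivAt.congr_deriv ((da.div_const 2).fun_mul (ds.const_mul r)) (Eq.symm ?_)
      rw [ea, es, hm]; field_simp; ring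
    · simp
      refine HasDerivAt.congr_deriv ((da.div_const 2).fun_mul (dc.const_sub 1)) (Eq.symm ?_)
      rw [ea, ec, hm]; field_simp; ring
  obtain ⟨Γ, hΓ⟩ : ∃ Γ : ℝ → ℝ → Fin 3 → ℝ, Γ = fun s t =>
    γ 0 + t • V 0 + ∫ u in (0:ℝ)..s, T (u, t) := ⟨_, rfl⟩
  have hds : dsV Γ = fun s t => T (s, t) := by
    ext1 s; ext1 t
    rw [hΓ]
    exact ((hasDerivAt_prim T cT s t).const_add _).deriv
  refine ⟨Γ, ?_, ?_, ?_, ?_⟩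
  · rw [hΓ]
    exact (contDiff_const.add (contDiff_snd.smul contDiff_const)).add (contDiff_prim T cT)
  · intro t₀ s
    have hdd : ∃ q, dsV (dsV Γ) s t₀ = 
      ![q / 2 * (1 + Ct (s, t₀)) - a (s, t₀) / 2 * (St (s, t₀) * (w s * Real.exp (t₀ * m s))),
      q / 2 * (r * St (s, t₀)) + a (s, t₀) / 2 * (r * (Ct (s, t₀) * (w s * Real.exp (t₀ * m s)))),
      q / 2 * (1 - Ct (s, t₀)) + a (s, t₀) / 2 * (St (s, t₀) * (w s * Real.exp (t₀ * m s)))] := by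
      obtain ⟨q, hq⟩ := das s t₀
      refine ⟨q, ?_⟩
      rw [hds]
      refine HasDerivAt.deriv ?_
      rw [hT]
      refine hasDerivAt_pi.2 fun i => ?_
      fin_cases i
      · simp
        refine HasDerivAt.congr_deriv ((hq.div_const 2).fun_mul ((dCt s t₀).const_add 1)) (Eq.symm ?_)
        ring
      · simp
        refine HasDerivAt.congr_deriv ((hq.div_const 2).fun_mul ((dSt s t₀).const_mul r)) (Eq.symm ?_)
        rfl
      · simp
        refine HasDerivAt.congr_deriv ((hq.div_const 2).fun_mul ((dCt s t₀).const_sub 1)) (Eq.symm ?_)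
        ring
    obtain ⟨q, hq⟩ := hdd
    have e := hCSt (s, t₀)
    rw [hq, hds, hT]
    refine ⟨?_, ?_, ?_⟩
    · simp [mink]
      linear_combination (a (s, t₀) ^ 2 / 4 * St (s, t₀) ^ 2) * hr + (a (s, t₀) ^ 2 / 2) * e
    · have : 0 < a (s, t₀) := by rw [ha]; exact mul_pos (Apos s) (Real.exp_pos _)
      simp [mink]; linarith
    · have h3 : a (s, t₀) * (w s * Real.exp (t₀ * m s)) = A s * w s := by
        rw [ha]; dsimp only
        rw [Real.exp_neg]
        have := Real.exp_ne_zero (t₀ * m s)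
        field_simp
      have h4 : (a (s, t₀) * (w s * Real.exp (t₀ * m s))) ^ 2 = 2 := by
        rw [h3, mul_pow]; exact hAw s
      simp [mink]
      generalize w s * Real.exp (t₀ * m s) = W at *
      linear_combination (q / 2 * St (s, t₀) + a (s, t₀) / 2 * (Ct (s, t₀) * W)) ^ 2 * hr
        + (q ^ 2 / 2 + a (s, t₀) ^ 2 * W ^ 2 / 2) * e + (1 / 2) * h4
  · intro s
    have h2 : ∫ u in (0:ℝ)..s, g1 u = γ s - γ 0 :=
      intervalIntegral.integral_eq_sub_of_hasDerivAt (fun x _ => d1 x)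
        (hg1.continuous.intervalIntegrable _ _)
    rw [hΓ]; simp [T0, h2]
  · intro s
    have h1 := hasDerivAt_prim_param T cT _ dTt s
    have h2 : ∫ u in (0:ℝ)..s, (P u • g2 u - P' u • g1 u) = V s - V 0 :=
      intervalIntegral.integral_eq_sub_of_hasDerivAt (fun x _ => dV x)
        (((hP.smul hg2).sub (hP'.smul hg1)).continuous.intervalIntegrable _ _)
    rw [h2] at h1
    rw [hΓ]
    have h3 := (((hasDerivAt_id (0:ℝ)).smul_const (V 0)).const_add (γ 0)).fun_add h1
    have h4 := h3.deriv
    simp at h4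
    exact h4

lemma smooth_deriv {E : Type} [NormedAddCommGroup E] [NormedSpace ℝ E] {f : ℝ → E}
    (hf : ContDiff ℝ (⊤ : ℕ∞) f) :
    ContDiff ℝ (⊤ : ℕ∞) (deriv f) ∧ ∀ s, HasDerivAt f (deriv f s) s :=
  ⟨(contDiff_infty_iff_deriv.1 hf).2, fun s => (contDiff_infty_iff_deriv.1 hf).1 s |>.hasDerivAt⟩

lemma contDiff_mink {f g : ℝ → Fin 3 → ℝ} (hf : ContDiff ℝ (⊤ : ℕ∞) f)
    (hg : ContDiff ℝ (⊤ : ℕ∞) g) : ContDiff ℝ (⊤ : ℕ∞) fun s => mink (f s) (g s) := by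
  have hf' := contDiff_pi.1 hf
  have hg' := contDiff_pi.1 hg
  unfold mink
  exact ((((hf' 0).mul (hg' 2)).add ((hf' 2).mul (hg' 0))).neg).add ((hf' 1).mul (hg' 1))

/-- every vector field `p₁ t + p₂ n + p₃ b` along a null curve, with
`p₂ = -p₃'` and `p₁ = (1/2)p₃'' + ∫₀ˢ κ' p₃ + c`, is the infinitesimal variation of a
motion through pseudo-arc parametrized null curves. -/
theorem stmt6 (γ : ℝ → Fin 3 → ℝ) (hγ : ContDiff ℝ (⊤ : ℕ∞) γ)
    (hnull : ∀ s, mink (deriv γ s) (deriv γ s) = 0)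
    (hfut : ∀ s, mink (deriv γ s) ![1, 0, 1] < 0)
    (hpa : ∀ s, mink (deriv (deriv γ) s) (deriv (deriv γ) s) = 1)
    (κ : ℝ → ℝ)
    (hκ : ∀ s, κ s = (1/4) * mink (deriv (deriv (deriv γ)) s) (deriv (deriv (deriv γ)) s))
    (t n b : ℝ → Fin 3 → ℝ)
    (ht : ∀ s, t s = deriv γ s)
    (hn : ∀ s, n s = deriv (deriv γ) s)
    (hb : ∀ s, b s = deriv (deriv (deriv γ)) s + (2 * κ s) • deriv γ s)
    (p₃ : ℝ → ℝ) (hp₃ : ContDiff ℝ (⊤ : ℕ∞) p₃) (c : ℝ)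
    (p₂ p₁ : ℝ → ℝ)
    (hp₂ : ∀ s, p₂ s = -deriv p₃ s)
    (hp₁ : ∀ s, p₁ s = (1/2) * deriv (deriv p₃) s + (∫ u in (0:ℝ)..s, deriv κ u * p₃ u) + c) :
    ∃ Γ : ℝ → ℝ → Fin 3 → ℝ,
      ContDiff ℝ (⊤ : ℕ∞) (fun p : ℝ × ℝ => Γ p.1 p.2) ∧
      (∀ t₀ : ℝ, ∀ s : ℝ,
        mink (dsV Γ s t₀) (dsV Γ s t₀) = 0 ∧
        mink (dsV Γ s t₀) ![1, 0, 1] < 0 ∧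
        mink (dsV (dsV Γ) s t₀) (dsV (dsV Γ) s t₀) = 1) ∧
      (∀ s, Γ s 0 = γ s) ∧
      (∀ s, deriv (fun τ => Γ s τ) 0 = p₁ s • t s + p₂ s • n s + p₃ s • b s) := by
  
  obtain ⟨s1, d1⟩ := smooth_deriv hγ
  obtain ⟨s2, d2⟩ := smooth_deriv s1
  obtain ⟨s3, d3⟩ := smooth_deriv s2
  obtain ⟨s4, d4⟩ := smooth_deriv s3
  obtain ⟨q1s, e1⟩ := smooth_deriv hp₃
  obtain ⟨q2s, e2⟩ := smooth_deriv q1s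
  obtain ⟨q3s, e3⟩ := smooth_deriv q2s
  generalize deriv (deriv (deriv (deriv γ))) = g4 at *
  generalize deriv (deriv (deriv γ)) = g3 at *
  generalize deriv (deriv γ) = g2 at *
  generalize deriv γ = g1 at *
  generalize deriv (deriv (deriv p₃)) = q3 at *
  generalize deriv (deriv p₃) = q2 at *
  generalize deriv p₃ = q1 at *
  have sκ : ContDiff ℝ (⊤ : ℕ∞) κ := by
    rw [show κ = _ from funext hκ]
    exact contDiff_const.mul (contDiff_mink s3 s3)
  obtain ⟨κ's, eκ⟩ := smooth_deriv sκ
  have hκ' : ∀ s, mink (g3 s) (g4 s) = 2 * deriv κ s := by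
    intro s
    have h := (mink_deriv (d4 s) (d4 s)).const_mul (1/4 : ℝ)
    have h2 := eκ s
    rw [← show κ = _ from funext hκ] at h
    have h3 := h.unique h2
    rw [mink_comm' (g4 s) (g3 s)] at h3
    linarith
  generalize deriv κ = κ' at *
  have dp₁ : ∀ s, HasDerivAt p₁ ((1/2) * q3 s + κ' s * p₃ s) s := by
    intro s
    rw [show p₁ = _ from funext hp₁]
    exact (((e3 s).const_mul (1/2 : ℝ)).fun_add
      (((κ's.mul hp₃).continuous.integral_hasStrictDerivAt 0 s).hasDerivAt)).add_const c
  have mtn : ∀ s, mink (g1 s) (g2 s) = 0 := by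
    intro s
    have h := (mink_deriv (d2 s) (d2 s)).unique (by
      simp only [hnull]; exact hasDerivAt_const s (0:ℝ))
    rw [mink_comm' (g2 s) (g1 s)] at h; linarith
  have mtg : ∀ s, mink (g1 s) (g3 s) = -1 := by
    intro s
    have h := (mink_deriv (d2 s) (d3 s)).unique (by
      simp only [mtn]; exact hasDerivAt_const s (0:ℝ))
    rw [hpa] at h; linarith
  have mng : ∀ s, mink (g2 s) (g3 s) = 0 := by
    intro s
    have h := (mink_deriv (d3 s) (d3 s)).unique (by
      simp only [hpa]; exact hasDerivAt_const s (1:ℝ))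
    rw [mink_comm' (g3 s) (g2 s)] at h; linarith
  have mt4 : ∀ s, mink (g1 s) (g4 s) = 0 := by
    intro s
    have h := (mink_deriv (d2 s) (d4 s)).unique (by
      simp only [mtg]; exact hasDerivAt_const s (-1:ℝ))
    rw [mng] at h; linarith
  have mn4 : ∀ s, mink (g2 s) (g4 s) = -(4 * κ s) := by
    intro s
    have h := (mink_deriv (d3 s) (d4 s)).unique (by
      simp only [mng]; exact hasDerivAt_const s (0:ℝ))
    rw [hκ]; linarith
  have lin : ∀ (s : ℝ) (y : Fin 3 → ℝ), mink y (g4 s + (2 * κ' s) • g1 s + (4 * κ s) • g2 s) =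
      mink y (g4 s) + 2 * κ' s * mink (g1 s) y + 4 * κ s * mink (g2 s) y := by
    intro s y; simp [mink]; ring
  have hX : ∀ s, g4 s + (2 * κ' s) • g1 s + (4 * κ s) • g2 s = 0 := by
    intro s
    refine mink_nondeg (g1 s) (g2 s) (g3 s) _ (hnull s) (mtn s) (mtg s) (hpa s) (mng s) ?_ ?_ ?_
    · rw [lin, mt4, hnull, mink_comm', mtn]; ring
    · rw [lin, mn4, mtn, hpa]; ring
    · rw [lin, hκ', mtg, mng]; ring
  have h4 : ∀ s, g4 s = -((2 * κ' s) • g1 s) - (4 * κ s) • g2 s := by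
    intro s
    rw [← sub_eq_zero, ← hX s]; abel
  obtain ⟨P, hP⟩ : ∃ P : ℝ → ℝ, P = fun s => p₁ s - q2 s - 2 * κ s * p₃ s := ⟨_, rfl⟩
  obtain ⟨P', hP'⟩ : ∃ P' : ℝ → ℝ, P' = fun s => -(1/2) * q3 s - κ' s * p₃ s - 2 * κ s * q1 s :=
    ⟨_, rfl⟩
  have sP' : ContDiff ℝ (⊤ : ℕ∞) P' := by rw [hP']; fun_prop
  have dP : ∀ s, HasDerivAt P (P' s) s := by
    intro s
    rw [hP, hP']
    refine HasDerivAt.congr_deriv (((dp₁ s).fun_sub (e3 s)).fun_sub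
      (((eκ s).const_mul 2).fun_mul (e1 s))) ?_
    ring
  have sP : ContDiff ℝ (⊤ : ℕ∞) P := by
    refine contDiff_infty_iff_deriv.2 ⟨fun s => (dP s).differentiableAt, ?_⟩
    rwa [show deriv P = P' from funext fun s => (dP s).deriv]
  refine core γ g1 g2 (fun s => p₁ s • t s + p₂ s • n s + p₃ s • b s) P P' s1 s2 sP sP' d1 d2 dP
    hnull hfut hpa ?_
  intro s
  rw [show t = _ from funext ht, show n = _ from funext hn, show b = _ from funext hb,
    show p₂ = _ from funext hp₂]
  refine HasDerivAt.congr_deriv ((((dp₁ s).fun_smul (d2 s)).fun_add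
    ((e2 s).fun_neg.fun_smul (d3 s))).fun_add
    ((e1 s).fun_smul ((d4 s).fun_add (((eκ s).const_mul 2).fun_smul (d2 s))))) ?_
  rw [h4, hP, hP']
  ext i
  simp
  ring
end
end

section
/- Let Γ : ℝ × J → ℝ³ be a smooth map such that each Γ(·,t) is a pseudo-arc parametrized null curve with curvature κ(s,t) and Frenet frame (t,n,b). If ∂Γ/∂t = 2κ t + 2 b, then κ satisfies the Korteweg–de Vries equation ∂κ/∂t = −(∂³κ/∂s³ + 6κ ∂κ/∂s). -/
noncomputable section

/-- Partial derivative in the second (time) variable, vector-valued. -/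
def dtV (f : ℝ → ℝ → Fin 3 → ℝ) : ℝ → ℝ → Fin 3 → ℝ := fun s t => deriv (fun x => f s x) t

/-- Partial derivative in the first (space) variable, scalar-valued. -/
def dsR (f : ℝ → ℝ → ℝ) : ℝ → ℝ → ℝ := fun s t => deriv (fun x => f x t) s

/-- Partial derivative in the second (time) variable, scalar-valued. -/
def dtR (f : ℝ → ℝ → ℝ) : ℝ → ℝ → ℝ := fun s t => deriv (fun x => f s x) t

def Sm {E : Type} [NormedAddCommGroup E] [NormedSpace ℝ E] (J : Set ℝ) (f : ℝ → ℝ → E) : Prop :=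
  ContDiffOn ℝ (⊤ : ℕ∞) (fun p : ℝ × ℝ => f p.1 p.2) (Set.univ ×ˢ J)

section
variable {E : Type} [NormedAddCommGroup E] [NormedSpace ℝ E] {J : Set ℝ} {f : ℝ → ℝ → E}

lemma Sm.at (hJ : IsOpen J) (hf : Sm J f) (s : ℝ) {t : ℝ} (ht : t ∈ J) :
    ContDiffAt ℝ (⊤ : ℕ∞) (fun p : ℝ × ℝ => f p.1 p.2) (s, t) :=
  hf.contDiffAt ((isOpen_univ.prod hJ).mem_nhds ⟨trivial, ht⟩)

lemma Sm.ds_fderiv (hJ : IsOpen J) (hf : Sm J f) (s : ℝ) {t : ℝ} (ht : t ∈ J) :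
    HasDerivAt (fun x => f x t) (fderiv ℝ (fun p : ℝ × ℝ => f p.1 p.2) (s, t) (1, 0)) s := by
  have h := ((hf.at hJ s ht).differentiableAt (by simp)).hasFDerivAt
  have h2 : HasDerivAt (fun x : ℝ => (x, t)) ((1 : ℝ), (0 : ℝ)) s :=
    (hasDerivAt_id s).prodMk (hasDerivAt_const s t)
  exact h.comp_hasDerivAt s h2

lemma Sm.dt_fderiv (hJ : IsOpen J) (hf : Sm J f) (s : ℝ) {t : ℝ} (ht : t ∈ J) :
    HasDerivAt (fun x => f s x) (fderiv ℝ (fun p : ℝ × ℝ => f p.1 p.2) (s, t) (0, 1)) t := by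
  have h := ((hf.at hJ s ht).differentiableAt (by simp)).hasFDerivAt
  have h2 : HasDerivAt (fun x : ℝ => (s, x)) ((0 : ℝ), (1 : ℝ)) t :=
    (hasDerivAt_const t s).prodMk (hasDerivAt_id t)
  exact h.comp_hasDerivAt t h2

lemma Sm.fd (hJ : IsOpen J) (hf : Sm J f) :
    ContDiffOn ℝ (⊤ : ℕ∞) (fderiv ℝ (fun p : ℝ × ℝ => f p.1 p.2)) (Set.univ ×ˢ J) :=
  hf.fderiv_of_isOpen (isOpen_univ.prod hJ) (by simp)

lemma Sm.ds (hJ : IsOpen J) (hf : Sm J f) : Sm J (fun s t => deriv (fun x => f x t) s) := by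
  refine ContDiffOn.congr ((hf.fd hJ).clm_apply (contDiffOn_const (c := ((1 : ℝ), (0 : ℝ))))) ?_
  rintro ⟨s, t⟩ ⟨_, ht⟩
  exact (hf.ds_fderiv hJ s ht).deriv

lemma Sm.hs (hJ : IsOpen J) (hf : Sm J f) (s : ℝ) {t : ℝ} (ht : t ∈ J) :
    HasDerivAt (fun x => f x t) (deriv (fun x => f x t) s) s :=
  (hf.ds_fderiv hJ s ht).differentiableAt.hasDerivAt

lemma Sm.ht (hJ : IsOpen J) (hf : Sm J f) (s : ℝ) {t : ℝ} (ht : t ∈ J) :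
    HasDerivAt (fun x => f s x) (deriv (fun x => f s x) t) t :=
  (hf.dt_fderiv hJ s ht).differentiableAt.hasDerivAt

lemma apply_deriv {G : ℝ × ℝ → (ℝ × ℝ →L[ℝ] E)} {G' : ℝ × ℝ →L[ℝ] (ℝ × ℝ →L[ℝ] E)}
    {c : ℝ → ℝ × ℝ} {c' : ℝ × ℝ} {x : ℝ} (hG : HasFDerivAt G G' (c x)) (hc : HasDerivAt c c' x)
    (v : ℝ × ℝ) : HasDerivAt (fun y => G (c y) v) (G' c' v) x :=
  (ContinuousLinearMap.apply ℝ E v).hasFDerivAt.comp_hasDerivAt x (hG.comp_hasDerivAt x hc)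

lemma Sm.comm (hJ : IsOpen J) (hf : Sm J f) (s : ℝ) {t : ℝ} (ht : t ∈ J) :
    deriv (fun x => deriv (fun y => f y x) s) t = deriv (fun y => deriv (fun x => f y x) t) s := by
  set F := fun p : ℝ × ℝ => f p.1 p.2 with hF
  have hd : HasFDerivAt (fderiv ℝ F) (fderiv ℝ (fderiv ℝ F) (s, t)) (s, t) :=
    (((hf.fd hJ).contDiffAt ((isOpen_univ.prod hJ).mem_nhds ⟨trivial, ht⟩)).differentiableAt
      (by simp)).hasFDerivAt
  have h1 : HasDerivAt (fun x : ℝ => (s, x)) ((0 : ℝ), (1 : ℝ)) t :=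
    (hasDerivAt_const t s).prodMk (hasDerivAt_id t)
  have h2 : HasDerivAt (fun x : ℝ => (x, t)) ((1 : ℝ), (0 : ℝ)) s :=
    (hasDerivAt_id s).prodMk (hasDerivAt_const s t)
  have e1 : HasDerivAt (fun x => fderiv ℝ F (s, x) (1, 0))
      (fderiv ℝ (fderiv ℝ F) (s, t) (0, 1) (1, 0)) t := apply_deriv (c := fun x => (s, x)) hd h1 _
  have e2 : HasDerivAt (fun x => fderiv ℝ F (x, t) (0, 1))
      (fderiv ℝ (fderiv ℝ F) (s, t) (1, 0) (0, 1)) s := apply_deriv (c := fun x => (x, t)) hd h2 _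
  have c1 : (fun x => deriv (fun y => f y x) s) =ᶠ[nhds t] fun x => fderiv ℝ F (s, x) (1, 0) := by
    filter_upwards [hJ.mem_nhds ht] with x hx using (hf.ds_fderiv hJ s hx).deriv
  have c2 : (fun y => deriv (fun x => f y x) t) = fun x => fderiv ℝ F (x, t) (0, 1) := by
    funext y
    exact (hf.dt_fderiv hJ y ht).deriv
  rw [c1.deriv_eq, c2, e1.deriv, e2.deriv]
  have hsym : IsSymmSndFDerivAt ℝ F (s, t) :=
    (hf.at hJ s ht).isSymmSndFDerivAt (by simp; exact WithTop.coe_le_coe.2 (le_top : (2 : ℕ∞) ≤ ⊤))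
  exact hsym.eq _ _
end

lemma mink_comm (a b : Fin 3 → ℝ) : mink a b = mink b a := by unfold mink; ring

lemma HasDerivAt.mink {a b : ℝ → Fin 3 → ℝ} {a' b' : Fin 3 → ℝ} {x : ℝ}
    (ha : HasDerivAt a a' x) (hb : HasDerivAt b b' x) :
    HasDerivAt (fun y => _root_.mink (a y) (b y)) (_root_.mink a' (b x) + _root_.mink (a x) b') x := by
  have ha := hasDerivAt_pi.1 ha
  have hb := hasDerivAt_pi.1 hb
  unfold _root_.mink
  refine ((((ha 0).mul (hb 2)).add ((ha 2).mul (hb 0))).neg.add ((ha 1).mul (hb 1))).congr_deriv ?_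
  ring

lemma gram_zero {v a b c : Fin 3 → ℝ} {k : ℝ} (aa : mink a a = 0) (ab : mink a b = 0)
    (bb : mink b b = 1) (ac : mink a c = -1) (bc : mink b c = 0) (cc : mink c c = k)
    (va : mink v a = 0) (vb : mink v b = 0) (vc : mink v c = 0) : v = 0 := by
  have hD : (a 0 * (b 1 * c 2 - b 2 * c 1) - a 1 * (b 0 * c 2 - b 2 * c 0)
      + a 2 * (b 0 * c 1 - b 1 * c 0)) ^ 2 = 1 := by
    have : (a 0 * (b 1 * c 2 - b 2 * c 1) - a 1 * (b 0 * c 2 - b 2 * c 0)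
      + a 2 * (b 0 * c 1 - b 1 * c 0)) ^ 2 = -(mink a a * (mink b b * mink c c - mink b c ^ 2)
      - mink a b * (mink a b * mink c c - mink b c * mink a c)
      + mink a c * (mink a b * mink b c - mink b b * mink a c)) := by
      unfold mink; ring
    rw [this, aa, ab, bb, ac, bc, cc]; ring
  set D := a 0 * (b 1 * c 2 - b 2 * c 1) - a 1 * (b 0 * c 2 - b 2 * c 0)
      + a 2 * (b 0 * c 1 - b 1 * c 0) with hDd
  have hD0 : D ≠ 0 := by rintro h; rw [h] at hD; norm_num at hD
  unfold mink at va vb vc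
  have h2 : D * v 2 = 0 := by
    rw [hDd]
    linear_combination (-(b 1 * c 2 - b 2 * c 1)) * va + (a 1 * c 2 - a 2 * c 1) * vb
      - (a 1 * b 2 - a 2 * b 1) * vc
  have h1 : D * v 1 = 0 := by
    rw [hDd]
    linear_combination (-(b 0 * c 2 - b 2 * c 0)) * va + (a 0 * c 2 - a 2 * c 0) * vb
      - (a 0 * b 2 - a 2 * b 0) * vc
  have h0 : D * v 0 = 0 := by
    rw [hDd]
    linear_combination (-(b 0 * c 1 - b 1 * c 0)) * va + (a 0 * c 1 - a 1 * c 0) * vb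
      - (a 0 * b 1 - a 1 * b 0) * vc
  funext i
  fin_cases i
  · simpa [hD0] using h0
  · simpa [hD0] using h1
  · simpa [hD0] using h2

/-- if a motion of pseudo-arc parametrized null curves satisfies
`∂Γ/∂t = 2κ t + 2 b`, then the curvature satisfies the KdV equation
`∂κ/∂t = -(∂³κ/∂s³ + 6κ ∂κ/∂s)`. -/
theorem stmt10 (J : Set ℝ) (hJopen : IsOpen J) (hJconn : J.OrdConnected)
    (Γ : ℝ → ℝ → Fin 3 → ℝ)
    (hΓ : ContDiffOn ℝ (⊤ : ℕ∞) (fun p : ℝ × ℝ => Γ p.1 p.2) (Set.univ ×ˢ J))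
    (hnull : ∀ s : ℝ, ∀ t ∈ J, mink (dsV Γ s t) (dsV Γ s t) = 0)
    (hfut : ∀ s : ℝ, ∀ t ∈ J, mink (dsV Γ s t) ![1, 0, 1] < 0)
    (hpa : ∀ s : ℝ, ∀ t ∈ J, mink (dsV (dsV Γ) s t) (dsV (dsV Γ) s t) = 1)
    (κ : ℝ → ℝ → ℝ)
    (hκ : ∀ s t, κ s t = (1/4) * mink (dsV (dsV (dsV Γ)) s t) (dsV (dsV (dsV Γ)) s t))
    (T N B : ℝ → ℝ → Fin 3 → ℝ)
    (hT : ∀ s t, T s t = dsV Γ s t)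
    (hN : ∀ s t, N s t = dsV (dsV Γ) s t)
    (hB : ∀ s t, B s t = dsV (dsV (dsV Γ)) s t + (2 * κ s t) • dsV Γ s t)
    (hmotion : ∀ s : ℝ, ∀ t ∈ J,
      dtV Γ s t = (2 * κ s t) • T s t + (2 : ℝ) • B s t) :
    ∀ s : ℝ, ∀ t ∈ J,
      dtR κ s t = -(dsR (dsR (dsR κ)) s t + 6 * κ s t * dsR κ s t) := by
  have g0 : Sm J Γ := hΓ
  have g1 : Sm J (dsV Γ) := g0.ds hJopen
  have g2 : Sm J (dsV (dsV Γ)) := g1.ds hJopen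
  have g3 : Sm J (dsV (dsV (dsV Γ))) := g2.ds hJopen
  have g4 : Sm J (dsV (dsV (dsV (dsV Γ)))) := g3.ds hJopen
  have g5 : Sm J (dsV (dsV (dsV (dsV (dsV Γ))))) := g4.ds hJopen
  have k0 : Sm J κ := by
    have h := fun i => contDiffOn_pi.1 g3 i
    have : ContDiffOn ℝ (⊤ : ℕ∞) (fun p : ℝ × ℝ => (1/4) * mink (dsV (dsV (dsV Γ)) p.1 p.2)
        (dsV (dsV (dsV Γ)) p.1 p.2)) (Set.univ ×ˢ J) := by
      unfold mink
      exact contDiffOn_const.mul (((((h 0).mul (h 2)).add ((h 2).mul (h 0))).neg).add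
        ((h 1).mul (h 1)))
    exact this.congr fun p _ => hκ p.1 p.2
  have k1 : Sm J (dsR κ) := k0.ds hJopen
  have k2 : Sm J (dsR (dsR κ)) := k1.ds hJopen
  intro s t ht
  -- derivatives along the curve at fixed time
  have d1 : ∀ x, HasDerivAt (fun y => dsV Γ y t) (dsV (dsV Γ) x t) x := fun x => g1.hs hJopen x ht
  have d2 : ∀ x, HasDerivAt (fun y => dsV (dsV Γ) y t) (dsV (dsV (dsV Γ)) x t) x := fun x => g2.hs hJopen x ht
  have d3 : ∀ x, HasDerivAt (fun y => dsV (dsV (dsV Γ)) y t) (dsV (dsV (dsV (dsV Γ))) x t) x := fun x => g3.hs hJopen x ht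
  have q0 : ∀ x, HasDerivAt (fun y => κ y t) (dsR κ x t) x := fun x => k0.hs hJopen x ht
  have q1 : ∀ x, HasDerivAt (fun y => dsR κ y t) (dsR (dsR κ) x t) x := fun x => k1.hs hJopen x ht
  have q2 : ∀ x, HasDerivAt (fun y => dsR (dsR κ) y t) (dsR (dsR (dsR κ)) x t) x := fun x => k2.hs hJopen x ht
  have key : ∀ {u v : ℝ → ℝ} {u' v' : ℝ} {x : ℝ}, HasDerivAt u u' x → HasDerivAt v v' x →
      (∀ y, u y = v y) → u' = v' := by
    intro u v u' v' x hu hv h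
    have : u = v := funext h
    subst this
    exact hu.unique hv
  have p11 := fun x => hnull x t ht
  have p22 := fun x => hpa x t ht
  have p12 : ∀ x, mink (dsV Γ x t) (dsV (dsV Γ) x t) = 0 := fun x => by
    have := key ((d1 x).mink (d1 x)) (hasDerivAt_const x 0) p11
    rw [mink_comm] at this
    linarith
  have p13 : ∀ x, mink (dsV Γ x t) (dsV (dsV (dsV Γ)) x t) = -1 := fun x => by
    have := key ((d1 x).mink (d2 x)) (hasDerivAt_const x 0) p12
    rw [p22] at this
    linarith
  have p23 : ∀ x, mink (dsV (dsV Γ) x t) (dsV (dsV (dsV Γ)) x t) = 0 := fun x => by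
    have := key ((d2 x).mink (d2 x)) (hasDerivAt_const x 1) p22
    rw [mink_comm] at this
    linarith
  have p33 : ∀ x, mink (dsV (dsV (dsV Γ)) x t) (dsV (dsV (dsV Γ)) x t) = 4 * κ x t := fun x => by
    rw [hκ]; ring
  have p14 : ∀ x, mink (dsV Γ x t) (dsV (dsV (dsV (dsV Γ))) x t) = 0 := fun x => by
    have := key ((d1 x).mink (d3 x)) (hasDerivAt_const x (-1)) p13
    rw [p23] at this
    linarith
  have p24 : ∀ x, mink (dsV (dsV Γ) x t) (dsV (dsV (dsV (dsV Γ))) x t) = -4 * κ x t := fun x => by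
    have := key ((d2 x).mink (d3 x)) (hasDerivAt_const x 0) p23
    rw [p33] at this
    linarith
  have p34 : ∀ x, mink (dsV (dsV (dsV Γ)) x t) (dsV (dsV (dsV (dsV Γ))) x t) = 2 * dsR κ x t :=
    fun x => by
    have := key ((d3 x).mink (d3 x)) ((q0 x).const_mul 4) p33
    rw [mink_comm] at this
    linarith
  -- structure equation
  have st : ∀ x, dsV (dsV (dsV (dsV Γ))) x t
      = (-4 * κ x t) • dsV (dsV Γ) x t + (-2 * dsR κ x t) • dsV Γ x t := fun x => by
    rw [← sub_eq_zero]
    have lin : ∀ (a b c d : Fin 3 → ℝ) (l m : ℝ), mink (a - (l • b + m • c)) d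
        = mink d a - l * mink d b - m * mink d c := by
      intros; simp [mink]; ring
    refine gram_zero (p11 x) (p12 x) (p22 x) (p13 x) (p23 x) (p33 x) ?_ ?_ ?_
    · rw [lin, p14, p12, p11]; ring
    · rw [lin, p24, p22, mink_comm _ (dsV Γ x t), p12]; ring
    · rw [lin, p34, mink_comm _ (dsV Γ x t), p13, mink_comm _ (dsV (dsV Γ) x t), p23]; ring
  -- the motion and its derivatives
  have w0 : ∀ x, dtV Γ x t = (6 * κ x t) • dsV Γ x t + (2 : ℝ) • dsV (dsV (dsV Γ)) x t := fun x => by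
    rw [hmotion x t ht, hT, hB]
    module
  have w1 : ∀ x, dtV (dsV Γ) x t = (2 * dsR κ x t) • dsV Γ x t
      + (-2 * κ x t) • dsV (dsV Γ) x t := fun x => by
    have e : dtV (dsV Γ) x t = deriv (fun y => dtV Γ y t) x := g0.comm hJopen x ht
    rw [e, funext w0]
    have := ((((q0 x).const_mul 6).smul (d1 x)).add ((d3 x).const_smul (2 : ℝ))).deriv
    refine this.trans ?_
    rw [st]
    module
  have w2 : ∀ x, dtV (dsV (dsV Γ)) x t = (2 * dsR (dsR κ) x t) • dsV Γ x t
      + (-2 * κ x t) • dsV (dsV (dsV Γ)) x t := fun x => by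
    have e : dtV (dsV (dsV Γ)) x t = deriv (fun y => dtV (dsV Γ) y t) x := g1.comm hJopen x ht
    rw [e, funext w1]
    have := ((((q1 x).const_mul 2).smul (d1 x)).add (((q0 x).const_mul (-2)).smul (d2 x))).deriv
    refine this.trans ?_
    module
  have w3 : ∀ x, dtV (dsV (dsV (dsV Γ))) x t
      = (2 * dsR (dsR (dsR κ)) x t + 4 * κ x t * dsR κ x t) • dsV Γ x t
      + (2 * dsR (dsR κ) x t + 8 * κ x t ^ 2) • dsV (dsV Γ) x t
      + (-2 * dsR κ x t) • dsV (dsV (dsV Γ)) x t := fun x => by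
    have e : dtV (dsV (dsV (dsV Γ))) x t = deriv (fun y => dtV (dsV (dsV Γ)) y t) x :=
      g2.comm hJopen x ht
    rw [e, funext w2]
    have := ((((q2 x).const_mul 2).smul (d1 x)).add (((q0 x).const_mul (-2)).smul (d3 x))).deriv
    refine this.trans ?_
    rw [st]
    module
  have hd : HasDerivAt (fun y => dsV (dsV (dsV Γ)) s y) (dtV (dsV (dsV (dsV Γ))) s t) t :=
    g3.ht hJopen s ht
  have hk : dtR κ s t = deriv (fun y => (1/4) * mink (dsV (dsV (dsV Γ)) s y)
      (dsV (dsV (dsV Γ)) s y)) t := by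
    unfold dtR
    congr 1
    funext y
    exact hκ s y
  rw [hk, ((hd.mink hd).const_mul (1/4)).deriv, w3]
  have lin : ∀ (a b c : Fin 3 → ℝ) (l m n : ℝ), mink (l • a + m • b + n • c) c
      = l * mink a c + m * mink b c + n * mink c c := by
    intros; simp [mink]; ring
  rw [mink_comm (dsV (dsV (dsV Γ)) s t) (_ + _), lin, p13, p23, p33]
  ring
end
end
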